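/- Assume α = 0 and that there exists a constant K > 0 such that Kξ + B(ξ) ∈ S_d^+ for every ξ ∈ S_d^+. Then for all u, ξ ∈ S_d^+ and all t ≥ 0: ⟨ξ, ψ(t,u)⟩ ≥ e^{−Kt} ⟨ξ, u⟩. -/

import Mathlib

open MeasureTheory Matrix Filter Topology
open scoped ENNReal

attribute [local instance] Matrix.frobeniusNormedAddCommGroup Matrix.frobeniusNormedSpace

noncomputable section

/-- The space of real `d × d` matrices (the symmetric positive semidefinite ones are singled
out via `Matrix.PosSemidef`, which over `ℝ` includes symmetry). With the local Frobenius-norm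
instance above, `‖·‖` is the Frobenius norm and `Matrix.trace (x * y)` is the associated trace
inner product. -/
abbrev Mat (d : ℕ) := Matrix (Fin d) (Fin d) ℝ

instance {d : ℕ} : MeasurableSpace (Mat d) :=
  (inferInstance : MeasurableSpace (Fin d → Fin d → ℝ))

variable {d : ℕ}

/-- The trace inner product `⟨x, y⟩ = tr (x y)`. -/
def trIP (x y : Mat d) : ℝ := (x * y).trace

/-- The set `S_d^+ \ {0}` of nonzero symmetric positive semidefinite matrices. -/
def coneNZ (d : ℕ) : Set (Mat d) := {ξ | ξ.PosSemidef ∧ ξ ≠ 0}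

/-- The (entrywise) integral `∫_{S_d^+ \ {0}} g(ξ) μ(dξ)` of a scalar function `g` against the
`S_d^+`-valued measure `μ(dξ) = ρ(ξ) ν(dξ)` represented by a base measure `ν` and a
matrix-valued density `ρ`. -/
def muInt (ν : Measure (Mat d)) (ρ : Mat d → Mat d) (g : Mat d → ℝ) : Mat d :=
  Matrix.of fun i j => ∫ ξ in coneNZ d, g ξ * ρ ξ i j ∂ν

/-- `F(u) = ⟨b,u⟩ + ∫_{S_d^+ \ {0}} (1 - e^{-⟨u,ξ⟩}) m(dξ)`. -/
def Ffun (b : Mat d) (m : Measure (Mat d)) (u : Mat d) : ℝ :=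
  trIP b u + ∫ ξ in coneNZ d, (1 - Real.exp (-(trIP u ξ))) ∂m

/-- `R(u) = -2uαu + Bᵀ(u) - ∫_{S_d^+ \ {0}} (e^{-⟨u,ξ⟩} - 1) μ(dξ)`, with `Bt = Bᵀ` and
`μ(dξ) = ρ(ξ) ν(dξ)`. -/
def Rfun (α : Mat d) (Bt : Mat d →L[ℝ] Mat d) (ν : Measure (Mat d)) (ρ : Mat d → Mat d)
    (u : Mat d) : Mat d :=
  (-2 : ℝ) • (u * α * u) + Bt u - muInt ν ρ (fun ξ => Real.exp (-(trIP u ξ)) - 1)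

/-- An admissible parameter set `(α, b, B, m, μ)`.  The `S_d^+`-valued σ-finite measure `μ` on
`S_d^+ \ {0}` is represented (via Radon–Nikodym) by its matrix-valued density `ρ` with respect
to a σ-finite base measure `ν`, so that `μ(dξ) = ρ(ξ) ν(dξ)` and
`tr(μ)(dξ) = tr(ρ(ξ)) ν(dξ)`; `Bt` denotes the adjoint `Bᵀ` of the linear drift `B` with
respect to the trace inner product.  Measures on `S_d^+ \ {0}` are realized as measures on
matrix space, all integrals against them being taken over `coneNZ d`. -/
structure Admissible (d : ℕ) where
  /-- linear diffusion coefficient `α ∈ S_d^+` -/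
  α : Mat d
  /-- constant drift `b ∈ S_d^+` -/
  b : Mat d
  /-- linear drift `B : S_d → S_d` -/
  B : Mat d →L[ℝ] Mat d
  /-- adjoint of the linear drift -/
  Bt : Mat d →L[ℝ] Mat d
  /-- constant jump term: a Borel measure `m` on `S_d^+ \ {0}` -/
  m : Measure (Mat d)
  /-- base measure of the linear jump coefficient `μ` -/
  ν : Measure (Mat d)
  /-- matrix-valued density of `μ` with respect to `ν` -/
  ρ : Mat d → Mat d
  hα : α.PosSemidef
  hb : b.PosSemidef
  /-- `b ⪰ (d-1) α` -/
  hbα : (b - ((d : ℝ) - 1) • α).PosSemidef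
  /-- `∫ (‖ξ‖ ∧ 1) m(dξ) < ∞` -/
  hm : IntegrableOn (fun ξ => min ‖ξ‖ 1) (coneNZ d) m
  hν : SigmaFinite ν
  hρmeas : Measurable ρ
  /-- `μ` is `S_d^+`-valued -/
  hρpsd : ∀ᵐ ξ ∂(ν.restrict (coneNZ d)), (ρ ξ).PosSemidef
  /-- `∫ ‖ξ‖ tr(μ)(dξ) < ∞` -/
  hμint : IntegrableOn (fun ξ => ‖ξ‖ * (ρ ξ).trace) (coneNZ d) ν
  /-- `Bt` is the adjoint of `B` -/
  hadj : ∀ u x : Mat d, trIP u (B x) = trIP (Bt u) x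
  /-- `⟨B(x),u⟩ ≥ 0` whenever `x, u ∈ S_d^+` with `⟨x,u⟩ = 0` -/
  hBpos : ∀ x u : Mat d, x.PosSemidef → u.PosSemidef → trIP x u = 0 → 0 ≤ trIP (B x) u

/-- `ψ` solves the generalized Riccati equation `∂_t ψ(t,u) = R(ψ(t,u))`, `ψ(0,u) = u`,
staying in `S_d^+` for initial conditions in `S_d^+`. -/
def IsRiccati (P : Admissible d) (ψ : ℝ → Mat d → Mat d) : Prop :=
  (∀ u : Mat d, u.PosSemidef → ψ 0 u = u) ∧
  (∀ t : ℝ, 0 ≤ t → ∀ u : Mat d, u.PosSemidef → (ψ t u).PosSemidef) ∧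
  (∀ u : Mat d, u.PosSemidef → ∀ t ∈ Set.Ici (0 : ℝ),
    HasDerivWithinAt (fun s => ψ s u) (Rfun P.α P.Bt P.ν P.ρ (ψ t u)) (Set.Ici 0) t)

/-- `φ(t,u) = ∫_0^t F(ψ(s,u)) ds`. -/
def phiFun (P : Admissible d) (ψ : ℝ → Mat d → Mat d) (t : ℝ) (u : Mat d) : ℝ :=
  ∫ s in (0 : ℝ)..t, Ffun P.b P.m (ψ s u)

/-- `p t x` is a family of Borel probability measures supported on `S_d^+` satisfying the
affine transform formula
`∫ e^{-⟨u,ξ⟩} p_t(x,dξ) = exp (-φ(t,u) - ⟨ψ(t,u),x⟩)`. -/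
def IsAffineKernel (P : Admissible d) (ψ : ℝ → Mat d → Mat d)
    (p : ℝ → Mat d → Measure (Mat d)) : Prop :=
  (∀ t : ℝ, 0 ≤ t → ∀ x : Mat d, x.PosSemidef → IsProbabilityMeasure (p t x)) ∧
  (∀ t : ℝ, 0 ≤ t → ∀ x : Mat d, x.PosSemidef → p t x {ξ : Mat d | ¬ ξ.PosSemidef} = 0) ∧
  (∀ t : ℝ, 0 ≤ t → ∀ u x : Mat d, u.PosSemidef → x.PosSemidef →
    ∫ ξ, Real.exp (-(trIP u ξ)) ∂(p t x) =
      Real.exp (-(phiFun P ψ t u) - trIP (ψ t u) x))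

/-- `Bt2` is the effective drift `B̃(u) = B(u) + ∫_{S_d^+ \ {0}} ⟨ξ,u⟩ μ(dξ)`, given as a
(continuous) linear map so that its operator exponential can be formed. -/
def IsEffectiveDrift (P : Admissible d) (Bt2 : Mat d →L[ℝ] Mat d) : Prop :=
  ∀ u : Mat d, Bt2 u = P.B u + muInt P.ν P.ρ (fun ξ => trIP ξ u)

/-- Weak convergence of `q t` to `π` as `t → ∞`: convergence of integrals of all bounded
continuous functions. -/
def WeakTendsto (q : ℝ → Measure (Mat d)) (π : Measure (Mat d)) : Prop :=
  ∀ f : BoundedContinuousFunction (Mat d) ℝ,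
    Tendsto (fun t => ∫ ξ, f ξ ∂(q t)) atTop (𝓝 (∫ ξ, f ξ ∂π))

/-- The trace pairing with a fixed matrix as a continuous linear map. -/
def trCLM (x : Mat d) : Mat d →L[ℝ] ℝ :=
  LinearMap.toContinuousLinearMap
    { toFun := fun y => trIP x y
      map_add' := fun a b => by simp [trIP, Matrix.mul_add]
      map_smul' := fun c a => by simp [trIP] }

lemma trCLM_apply (x y : Mat d) : trCLM x y = trIP x y := rfl

lemma trIP_comm (x y : Mat d) : trIP x y = trIP y x := Matrix.trace_mul_comm x y

lemma trIP_nonneg {x y : Mat d} (hx : x.PosSemidef) (hy : y.PosSemidef) : 0 ≤ trIP x y := by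
  obtain ⟨m, v, hv⟩ := Matrix.posSemidef_iff_eq_sum_vecMulVec.mp hx
  rw [hv, trIP, Finset.sum_mul, Matrix.trace_sum]
  refine Finset.sum_nonneg fun i _ => ?_
  rw [Matrix.vecMulVec_mul, Matrix.trace_vecMulVec, dotProduct_comm, ← Matrix.dotProduct_mulVec]
  exact hy.dotProduct_mulVec_nonneg (v i)

lemma abs_entry_le {x : Mat d} (hx : x.PosSemidef) (i j : Fin d) : |x i j| ≤ x.trace := by
  have hsym : x j i = x i j := by simpa using hx.1.apply i j
  have hle : ∀ k, x k k ≤ x.trace := fun k =>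
    Finset.single_le_sum (f := fun k => x k k) (fun k _ => hx.diag_nonneg) (Finset.mem_univ k)
  have h1 := hx.dotProduct_mulVec_nonneg (Pi.single i 1 + Pi.single j 1)
  have h2 := hx.dotProduct_mulVec_nonneg (Pi.single i 1 - Pi.single j 1)
  simp [Matrix.mulVec_add, Matrix.mulVec_sub, add_dotProduct, sub_dotProduct, hsym] at h1 h2
  have := hle i
  have := hle j
  rw [abs_le]
  constructor <;> linarith

lemma measurable_entry (i j : Fin d) : Measurable (fun ξ : Mat d => ξ i j) :=
  (measurable_pi_apply j).comp (measurable_pi_apply (X := fun _ : Fin d => Fin d → ℝ) i)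

lemma measurable_trIP (u : Mat d) : Measurable (fun ξ : Mat d => trIP u ξ) := by
  simp only [trIP, Matrix.trace, Matrix.diag, Matrix.mul_apply]
  exact Finset.measurable_sum _ fun i _ => Finset.measurable_sum _ fun j _ =>
    (measurable_entry j i).const_mul _

lemma measurableSet_coneNZ : MeasurableSet (coneNZ d) := by
  have h1 : IsClosed {ξ : Fin d → Fin d → ℝ | Matrix.PosSemidef (Matrix.of ξ)} := by
    simp only [Matrix.posSemidef_iff_dotProduct_mulVec, Matrix.IsHermitian, Set.ofPred_and,
      Set.ofPred_forall]
    refine IsClosed.inter (isClosed_eq ?_ ?_) (isClosed_iInter fun v => isClosed_le ?_ ?_)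
    · exact (Continuous.matrix_conjTranspose continuous_id)
    · exact continuous_id
    · exact continuous_const
    · simp only [dotProduct, Matrix.mulVec, Matrix.of_apply]
      fun_prop
  have h2 : MeasurableSet ({ξ : Fin d → Fin d → ℝ | Matrix.PosSemidef (Matrix.of ξ)} ∩ {0}ᶜ) :=
    h1.measurableSet.inter (measurableSet_singleton _).compl
  exact h2

lemma exists_trIP_bound (u : Mat d) : ∃ C : ℝ, 0 ≤ C ∧ ∀ ξ : Mat d, |trIP u ξ| ≤ C * ‖ξ‖ := by
  have h : ∃ C : ℝ, 0 < C ∧ ∀ ξ : Mat d, ‖trCLM u ξ‖ ≤ C * ‖ξ‖ := ContinuousLinearMap.bound (trCLM u)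
  obtain ⟨C, hC, h⟩ := h
  exact ⟨C, hC.le, fun ξ => h ξ⟩

lemma integrable_entry (P : Admissible d) {u : Mat d} (hu : u.PosSemidef) (i j : Fin d) :
    IntegrableOn (fun ξ => (Real.exp (-(trIP u ξ)) - 1) * P.ρ ξ i j) (coneNZ d) P.ν := by
  obtain ⟨C, hC, hb⟩ := exists_trIP_bound u
  refine Integrable.mono' (P.hμint.const_mul C) ?_ ?_
  · exact (((Real.measurable_exp.comp (measurable_trIP u).neg).sub_const 1).mul
      ((measurable_entry i j).comp P.hρmeas)).aestronglyMeasurable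
  · filter_upwards [P.hρpsd, ae_restrict_mem measurableSet_coneNZ] with ξ hρ hξ
    have h0 : 0 ≤ trIP u ξ := trIP_nonneg hu hξ.1
    have h1 : trIP u ξ ≤ C * ‖ξ‖ := (le_abs_self _).trans (hb ξ)
    have h2 : |Real.exp (-(trIP u ξ)) - 1| ≤ trIP u ξ := by
      have a := Real.add_one_le_exp (-(trIP u ξ))
      have b : Real.exp (-(trIP u ξ)) ≤ 1 := Real.exp_le_one_iff.mpr (by linarith)
      rw [abs_le]; constructor <;> linarith
    rw [norm_mul, ← mul_assoc]
    exact mul_le_mul (h2.trans h1) (abs_entry_le hρ i j) (abs_nonneg _) (by positivity)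

lemma trIP_muInt_nonpos (P : Admissible d) {u x : Mat d} (hu : u.PosSemidef)
    (hx : x.PosSemidef) :
    trIP x (muInt P.ν P.ρ (fun ξ => Real.exp (-(trIP u ξ)) - 1)) ≤ 0 := by
  have key : trIP x (muInt P.ν P.ρ (fun ξ => Real.exp (-(trIP u ξ)) - 1)) =
      ∫ ξ in coneNZ d, (Real.exp (-(trIP u ξ)) - 1) * trIP x (P.ρ ξ) ∂P.ν := by
    simp only [trIP, Matrix.trace, Matrix.diag, Matrix.mul_apply (M := x), muInt, Matrix.of_apply]
    simp only [← integral_const_mul, Finset.mul_sum]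
    have hI := fun i j => (integrable_entry P hu i j).const_mul (x j i)
    simp only [trIP, Matrix.trace, Matrix.diag] at hI
    simp only [mul_left_comm _ (x _ _)]
    rw [integral_finsetSum _ fun i _ => integrable_finsetSum _ fun j _ => hI j i]
    refine Finset.sum_congr rfl fun i _ => ?_
    rw [integral_finsetSum _ fun j _ => hI j i]
  rw [key]
  refine integral_nonpos_of_ae ?_
  filter_upwards [P.hρpsd, ae_restrict_mem measurableSet_coneNZ] with ξ hρ hξ
  have h0 : 0 ≤ trIP u ξ := trIP_nonneg hu hξ.1
  have b : Real.exp (-(trIP u ξ)) ≤ 1 := Real.exp_le_one_iff.mpr (by linarith)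
  exact mul_nonpos_of_nonpos_of_nonneg (by linarith) (trIP_nonneg hx hρ)

/-- Proposition 4.2 (lower bound for `ψ`): if `α = 0` and `Kξ + B(ξ) ⪰ 0` on `S_d^+` for some
`K > 0`, then `⟨ξ, ψ(t,u)⟩ ≥ e^{-Kt} ⟨ξ, u⟩` for all `u, ξ ∈ S_d^+` and `t ≥ 0`. -/
theorem psi_exponential_lower_bound
    (d : ℕ) (hd : 2 ≤ d) (P : Admissible d)
    (ψ : ℝ → Mat d → Mat d) (hψ : IsRiccati P ψ)
    (hα0 : P.α = 0)
    (K : ℝ) (hK : 0 < K)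
    (hKB : ∀ ξ : Mat d, ξ.PosSemidef → (K • ξ + P.B ξ).PosSemidef) :
    ∀ u ξ : Mat d, u.PosSemidef → ξ.PosSemidef → ∀ t : ℝ, 0 ≤ t →
      Real.exp (-(K * t)) * trIP ξ u ≤ trIP ξ (ψ t u) := by
  intro u ξ hu hξ t ht
  obtain ⟨h0, hpsd, hder⟩ := hψ
  have hd1 : ∀ s ∈ Set.Ici (0 : ℝ), HasDerivWithinAt (fun s => trIP ξ (ψ s u))
      (trIP ξ (Rfun P.α P.Bt P.ν P.ρ (ψ s u))) (Set.Ici 0) s := fun s hs =>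
    (trCLM ξ).hasFDerivAt.comp_hasDerivWithinAt s (hder u hu s hs)
  have hlow : ∀ s ∈ Set.Ici (0 : ℝ),
      -(K * trIP ξ (ψ s u)) ≤ trIP ξ (Rfun P.α P.Bt P.ν P.ρ (ψ s u)) := by
    intro s hs
    have hp := hpsd s hs u hu
    have e1 : trIP ξ (Rfun P.α P.Bt P.ν P.ρ (ψ s u)) = trIP ξ (P.Bt (ψ s u)) -
        trIP ξ (muInt P.ν P.ρ (fun ζ => Real.exp (-(trIP (ψ s u) ζ)) - 1)) := by
      simp only [Rfun, hα0, Matrix.mul_zero, Matrix.zero_mul, smul_zero, zero_add]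
      exact map_sub (trCLM ξ) _ _
    have e2 : trIP ξ (P.Bt (ψ s u)) = trIP (ψ s u) (P.B ξ) := by
      rw [P.hadj, trIP_comm]
    have e3 : trIP (ψ s u) (K • ξ + P.B ξ) = K * trIP ξ (ψ s u) + trIP (ψ s u) (P.B ξ) := by
      rw [trIP_comm ξ, ← trCLM_apply, map_add, map_smul]; rfl
    have e4 := trIP_nonneg hp (hKB ξ hξ)
    have e5 := trIP_muInt_nonpos P hp hξ
    rw [e1, e2]
    linarith
  have hd2 : ∀ s ∈ Set.Ici (0 : ℝ),
      HasDerivWithinAt (fun s => Real.exp (K * s) * trIP ξ (ψ s u))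
      (Real.exp (K * s) * K * trIP ξ (ψ s u) +
        Real.exp (K * s) * trIP ξ (Rfun P.α P.Bt P.ν P.ρ (ψ s u))) (Set.Ici 0) s := by
    intro s hs
    have h : HasDerivAt (fun s : ℝ => K * s) K s := by
      simpa using (hasDerivAt_id s).const_mul K
    exact (h.exp.hasDerivWithinAt).mul (hd1 s hs)
  have hmono := monotoneOn_of_hasDerivWithinAt_nonneg (convex_Ici (0 : ℝ))
    (fun s hs => (hd2 s hs).continuousWithinAt)
    (fun s hs => (hd2 s (interior_subset hs)).mono interior_subset)
    (fun s hs => by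
      have := hlow s (interior_subset hs)
      have h2 : 0 ≤ Real.exp (K * s) * (K * trIP ξ (ψ s u) +
        trIP ξ (Rfun P.α P.Bt P.ν P.ρ (ψ s u))) :=
        mul_nonneg (Real.exp_pos _).le (by linarith)
      linarith)
  have hfin := hmono (Set.self_mem_Ici) (Set.mem_Ici.mpr ht) ht
  simp only [mul_zero, Real.exp_zero, one_mul, h0 u hu] at hfin
  calc Real.exp (-(K * t)) * trIP ξ u
      ≤ Real.exp (-(K * t)) * (Real.exp (K * t) * trIP ξ (ψ t u)) :=
        mul_le_mul_of_nonneg_left hfin (Real.exp_pos _).le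
    _ = trIP ξ (ψ t u) := by
        rw [← mul_assoc, ← Real.exp_add]; simp
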